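/- arXiv:2402.11731 — 4 statements merged into one kernel-verified Lean document; each statement's English description precedes it below -/
import Mathlib

section
/- Let 1 < p < 2, p̃ = (1+p)/2, C > 1.1, and c > 0. Let F : ℝ² → ℝ be twice continuously differentiable and let Q ⊂ ℝ² be a closed axis-parallel square with side length δ_Q. Let z₁ = (x₁, y₁) and z₂ = (x₁, y₂) be points of CQ (with equal first coordinates) satisfying |y₁ − y₂| ≥ c·δ_Q. Then δ_Q^{2−p} · | Av_Q ∂_y F − (F(z₂) − F(z₁))/(y₂ − y₁) |^p ≤ C_p · δ_Q² · ( (1/|CQ|) ∫_{CQ} |∇²F(z)|^{p̃} dz )^{p/p̃}, where C_p depends only on c, C, and p. -/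
open MeasureTheory

/-- The closed axis-parallel square with lower-left corner `(qx, qy)` and side length `δ`. -/
def closedSq (qx qy δ : ℝ) : Set (ℝ × ℝ) :=
  Set.Icc qx (qx + δ) ×ˢ Set.Icc qy (qy + δ)

/-- `openSq qx qy δ C` is the open axis-parallel square `CQ` with the same center as the
closed square `Q` with corner `(qx, qy)` and side `δ`, and side length `C·δ`. -/
def openSq (qx qy δ C : ℝ) : Set (ℝ × ℝ) :=
  Set.Ioo (qx + δ / 2 - C * δ / 2) (qx + δ / 2 + C * δ / 2) ×ˢ
    Set.Ioo (qy + δ / 2 - C * δ / 2) (qy + δ / 2 + C * δ / 2)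

/-- `Av_Q ∂_y F = (1/|Q|) ∫_Q ∂_y F`. -/
noncomputable def avDy (F : ℝ × ℝ → ℝ) (qx qy δ : ℝ) : ℝ :=
  (δ ^ 2)⁻¹ * ∫ z in closedSq qx qy δ, fderiv ℝ F z (0, 1)

open intervalIntegral

/-- Evaluations of the second derivative at unit vectors are bounded by its norm. -/
lemma abs_fderiv_fderiv_le {F : ℝ × ℝ → ℝ} (z v w : ℝ × ℝ) (hv : ‖v‖ ≤ 1) (hw : ‖w‖ ≤ 1) :
    |fderiv ℝ (fderiv ℝ F) z v w| ≤ ‖iteratedFDeriv ℝ 2 F z‖ := by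
  have h := (iteratedFDeriv ℝ 2 F z).le_opNorm ![v, w]
  rw [iteratedFDeriv_two_apply] at h
  simp only [Fin.prod_univ_two, Matrix.cons_val_zero, Matrix.cons_val_one, Real.norm_eq_abs] at h
  refine h.trans (mul_le_of_le_one_right (norm_nonneg _) ?_)
  exact mul_le_one₀ hv (norm_nonneg _) hw

lemma hasDerivAt_mk_left {E : Type*} [NormedAddCommGroup E] [NormedSpace ℝ E] {f : ℝ × ℝ → E}
    (hf : Differentiable ℝ f) (x y : ℝ) :
    HasDerivAt (fun u => f (u, y)) (fderiv ℝ f (x, y) (1, 0)) x :=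
  (hf (x, y)).hasFDerivAt.comp_hasDerivAt x ((hasDerivAt_id x).prodMk (hasDerivAt_const x y))

lemma hasDerivAt_mk_right {E : Type*} [NormedAddCommGroup E] [NormedSpace ℝ E] {f : ℝ × ℝ → E}
    (hf : Differentiable ℝ f) (x y : ℝ) :
    HasDerivAt (fun r => f (x, r)) (fderiv ℝ f (x, y) (0, 1)) y :=
  (hf (x, y)).hasFDerivAt.comp_hasDerivAt y ((hasDerivAt_const y x).prodMk (hasDerivAt_id y))

lemma continuous_norm_iteratedFDeriv_two {F : ℝ × ℝ → ℝ} (hF : ContDiff ℝ 2 F) :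
    Continuous fun z => ‖iteratedFDeriv ℝ 2 F z‖ :=
  (hF.continuous_iteratedFDeriv (m := 2) le_rfl).norm

/-- The oscillation of a function on an interval is at most the integral of a bound for its
derivative. -/
lemma abs_sub_le_integral_of_abs_deriv_le {f f' g : ℝ → ℝ} {a b s t : ℝ}
    (hf : ∀ x, HasDerivAt f (f' x) x) (hf' : Continuous f') (hg : Continuous g)
    (hle : ∀ x ∈ Set.Icc a b, |f' x| ≤ g x) (hs : s ∈ Set.Icc a b) (ht : t ∈ Set.Icc a b) :
    |f t - f s| ≤ ∫ x in a..b, g x := by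
  wlog hst : s ≤ t generalizing s t
  · rw [abs_sub_comm]
    exact this ht hs (le_of_not_ge hst)
  rw [← integral_eq_sub_of_hasDerivAt (fun x _ => hf x) (hf'.intervalIntegrable s t)]
  have h1 : |∫ x in s..t, f' x| ≤ ∫ x in s..t, g x := by
    refine (abs_integral_le_integral_abs hst).trans ?_
    refine integral_mono_on hst (hf'.abs.intervalIntegrable _ _) (hg.intervalIntegrable _ _) ?_
    exact fun x hx => hle x ⟨hs.1.trans hx.1, hx.2.trans ht.2⟩
  refine h1.trans (integral_mono_interval hs.1 hst ht.2 ?_ (hg.intervalIntegrable _ _))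
  filter_upwards [ae_restrict_mem measurableSet_Ioc] with x hx
  exact (abs_nonneg _).trans (hle x (Set.Ioc_subset_Icc_self hx))

lemma abs_fderiv_sub_fderiv_le {F : ℝ × ℝ → ℝ} (hF : ContDiff ℝ 2 F) {α β y y' : ℝ} (x : ℝ)
    (v : ℝ × ℝ) (hv : ‖v‖ ≤ 1) (hy : y ∈ Set.Icc α β) (hy' : y' ∈ Set.Icc α β) :
    |fderiv ℝ F (x, y') v - fderiv ℝ F (x, y) v| ≤
      ∫ r in α..β, ‖iteratedFDeriv ℝ 2 F (x, r)‖ := by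
  have hF1 : ContDiff ℝ 1 (fderiv ℝ F) := hF.fderiv_right (by norm_num)
  have hc : Continuous (fderiv ℝ (fderiv ℝ F)) := hF1.continuous_fderiv (by norm_num)
  refine abs_sub_le_integral_of_abs_deriv_le
    (f := fun r => fderiv ℝ F (x, r) v)
    (f' := fun r => fderiv ℝ (fderiv ℝ F) (x, r) (0, 1) v) (fun r => ?_) ?_ ?_ ?_ hy hy'
  · exact (hasDerivAt_mk_right (hF1.differentiable (by norm_num)) x r).clm_apply
      (hasDerivAt_const r v) |>.congr_deriv (by simp)
  · fun_prop
  · exact (continuous_norm_iteratedFDeriv_two hF).comp (by fun_prop)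
  · exact fun r _ => abs_fderiv_fderiv_le _ _ _ (by simp [Prod.norm_def]) hv

/-- Two vertical difference quotients along the same line differ by at most the integral of the
second derivative along that line. -/
lemma abs_slope_sub_slope_le {F : ℝ × ℝ → ℝ} (hF : ContDiff ℝ 2 F) {α β s t s' t' : ℝ} (x : ℝ)
    (hs : s ∈ Set.Icc α β) (ht : t ∈ Set.Icc α β) (hs' : s' ∈ Set.Icc α β)
    (ht' : t' ∈ Set.Icc α β) (hst : s ≠ t) (hst' : s' ≠ t') :
    |(F (x, t) - F (x, s)) / (t - s) - (F (x, t') - F (x, s')) / (t' - s')| ≤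
      ∫ r in α..β, ‖iteratedFDeriv ℝ 2 F (x, r)‖ := by
  have hd : Differentiable ℝ F := hF.differentiable (by norm_num)
  have mvt : ∀ s t : ℝ, s ∈ Set.Icc α β → t ∈ Set.Icc α β → s ≠ t → ∃ ξ ∈ Set.Icc α β,
      fderiv ℝ F (x, ξ) (0, 1) = (F (x, t) - F (x, s)) / (t - s) := by
    intro s t hs ht hst
    wlog hlt : s < t generalizing s t
    · obtain ⟨ξ, hξ, h⟩ := this t s ht hs hst.symm (lt_of_le_of_ne (not_lt.1 hlt) hst.symm)
      refine ⟨ξ, hξ, h.trans ?_⟩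
      rw [← neg_div_neg_eq, neg_sub, neg_sub]
    · obtain ⟨ξ, hξ, h⟩ := exists_hasDerivAt_eq_slope (fun r => F (x, r))
        (fun r => fderiv ℝ F (x, r) (0, 1)) hlt
        (hF.continuous.comp (by fun_prop)).continuousOn
        (fun r _ => hasDerivAt_mk_right hd x r)
      exact ⟨ξ, ⟨hs.1.trans hξ.1.le, hξ.2.le.trans ht.2⟩, h⟩
  obtain ⟨ξ, hξ, h⟩ := mvt s t hs ht hst
  obtain ⟨η, hη, h'⟩ := mvt s' t' hs' ht' hst'
  rw [← h, ← h']
  exact abs_fderiv_sub_fderiv_le hF x _ (by simp [Prod.norm_def]) hη hξ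

/-- A mixed second difference is bounded by the integral of the second derivative. -/
lemma abs_mixed_difference_le {F : ℝ × ℝ → ℝ} (hF : ContDiff ℝ 2 F) {a b α β x x' y y' : ℝ}
    (hx : x ∈ Set.Icc a b) (hx' : x' ∈ Set.Icc a b)
    (hy : y ∈ Set.Icc α β) (hy' : y' ∈ Set.Icc α β) :
    |(F (x', y') - F (x', y)) - (F (x, y') - F (x, y))| ≤
      ∫ u in a..b, ∫ r in α..β, ‖iteratedFDeriv ℝ 2 F (u, r)‖ := by
  have hd : Differentiable ℝ F := hF.differentiable (by norm_num)
  have hc : Continuous (fderiv ℝ F) := hF.continuous_fderiv (by norm_num)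
  refine abs_sub_le_integral_of_abs_deriv_le (f := fun u => F (u, y') - F (u, y))
    (f' := fun u => fderiv ℝ F (u, y') (1, 0) - fderiv ℝ F (u, y) (1, 0))
    (fun u => (hasDerivAt_mk_left hd u y').sub (hasDerivAt_mk_left hd u y)) ?_ ?_ ?_ hx hx'
  · fun_prop
  · exact continuous_parametric_intervalIntegral_of_continuous'
      (f := fun u r => ‖iteratedFDeriv ℝ 2 F (u, r)‖) (continuous_norm_iteratedFDeriv_two hF) _ _
  · exact fun u _ => abs_fderiv_sub_fderiv_le hF u _ (by simp [Prod.norm_def]) hy hy'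

lemma integrableOn_Icc_prod_Icc {f : ℝ × ℝ → ℝ} (hf : Continuous f) (a b α β : ℝ) :
    IntegrableOn f (Set.Icc a b ×ˢ Set.Icc α β) :=
  hf.continuousOn.integrableOn_compact (isCompact_Icc.prod isCompact_Icc)

lemma avDy_eq {F : ℝ × ℝ → ℝ} (hF : ContDiff ℝ 1 F) (qx qy : ℝ) {δ : ℝ} (hδ : 0 < δ) :
    avDy F qx qy δ = δ⁻¹ * ∫ x in qx..(qx + δ), (F (x, qy + δ) - F (x, qy)) / (qy + δ - qy) := by
  have hc : Continuous (fderiv ℝ F) := hF.continuous_fderiv (by norm_num)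
  have hd : Differentiable ℝ F := hF.differentiable (by norm_num)
  have hg : Continuous fun z => fderiv ℝ F z (0, 1) := by fun_prop
  have h1 : ∀ x, ∫ y in Set.Icc qy (qy + δ), fderiv ℝ F (x, y) (0, 1) =
      F (x, qy + δ) - F (x, qy) := by
    intro x
    rw [integral_Icc_eq_integral_Ioc, ← integral_of_le (by linarith)]
    exact integral_eq_sub_of_hasDerivAt (fun y _ => hasDerivAt_mk_right hd x y)
      ((hg.comp (by fun_prop : Continuous fun y : ℝ => (x, y))).intervalIntegrable _ _)
  rw [avDy, closedSq, Measure.volume_eq_prod,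
    setIntegral_prod _ (integrableOn_Icc_prod_Icc hg _ _ _ _)]
  simp_rw [h1]
  rw [integral_Icc_eq_integral_Ioc, ← integral_of_le (by linarith), intervalIntegral.integral_div]
  rw [add_sub_cancel_left]
  field_simp

lemma setIntegral_Ioo_prod_Ioo {f : ℝ × ℝ → ℝ} (hf : Continuous f) {a b α β : ℝ} (hab : a ≤ b)
    (hαβ : α ≤ β) :
    ∫ z in Set.Ioo a b ×ˢ Set.Ioo α β, f z = ∫ x in a..b, ∫ y in α..β, f (x, y) := by
  rw [Measure.volume_eq_prod, setIntegral_prod _ ((integrableOn_Icc_prod_Icc hf a b α β).mono_set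
    (Set.prod_mono Set.Ioo_subset_Icc_self Set.Ioo_subset_Icc_self)),
    integral_of_le hab, integral_Ioc_eq_integral_Ioo]
  simp_rw [integral_of_le hαβ, integral_Ioc_eq_integral_Ioo]

/-- The `L¹` form of the estimate: the averaged derivative differs from a difference quotient by
at most a multiple of the integral of the second derivative. -/
lemma abs_avDy_sub_slope_le {F : ℝ × ℝ → ℝ} (hF : ContDiff ℝ 2 F)
    {qx qy δ c a b α β x₁ y₁ y₂ : ℝ} (hδ : 0 < δ) (hc : 0 < c)
    (ha : a ≤ qx) (hb : qx + δ ≤ b) (hα : α ≤ qy) (hβ : qy + δ ≤ β)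
    (hx₁ : x₁ ∈ Set.Icc a b) (hy₁ : y₁ ∈ Set.Icc α β) (hy₂ : y₂ ∈ Set.Icc α β)
    (hy : c * δ ≤ |y₁ - y₂|) :
    |avDy F qx qy δ - (F (x₁, y₂) - F (x₁, y₁)) / (y₂ - y₁)| ≤
      (1 + c⁻¹) * δ⁻¹ * ∫ z in Set.Ioo a b ×ˢ Set.Ioo α β, ‖iteratedFDeriv ℝ 2 F z‖ := by
  have hcδ : 0 < c * δ := mul_pos hc hδ
  have hne : y₁ ≠ y₂ := by
    rintro rfl
    simp only [sub_self, abs_zero] at hy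
    linarith
  set Φ : ℝ → ℝ := fun u => ∫ r in α..β, ‖iteratedFDeriv ℝ 2 F (u, r)‖
  have hΦc : Continuous Φ := continuous_parametric_intervalIntegral_of_continuous'
      (f := fun u r => ‖iteratedFDeriv ℝ 2 F (u, r)‖) (continuous_norm_iteratedFDeriv_two hF) _ _
  rw [setIntegral_Ioo_prod_Ioo (continuous_norm_iteratedFDeriv_two hF) (by linarith)
    (by linarith), avDy_eq (hF.of_le (by norm_num)) qx qy hδ]
  set M : ℝ := ∫ u in a..b, Φ u
  set D : ℝ := (F (x₁, y₂) - F (x₁, y₁)) / (y₂ - y₁) with hD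
  have hGc : Continuous fun x => (F (x, qy + δ) - F (x, qy)) / (qy + δ - qy) := by
    have := hF.continuous
    fun_prop
  have hpt : ∀ x ∈ Set.Icc qx (qx + δ),
      |(F (x, qy + δ) - F (x, qy)) / (qy + δ - qy) - D| ≤ Φ x + M / (c * δ) := by
    intro x hx
    have h1 := abs_slope_sub_slope_le hF (α := α) (β := β) (s := qy) (t := qy + δ) (s' := y₁)
      (t' := y₂) x ⟨hα, by linarith⟩ ⟨by linarith, hβ⟩ hy₁ hy₂ (by linarith) hne
    have h2 := abs_mixed_difference_le hF hx₁ ⟨ha.trans hx.1, hx.2.trans hb⟩ hy₁ hy₂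
    have h3 : |(F (x, y₂) - F (x, y₁)) / (y₂ - y₁) - D| ≤ M / (c * δ) := by
      rw [hD, ← sub_div, abs_div]
      rw [abs_sub_comm] at hy
      exact div_le_div₀ ((abs_nonneg _).trans h2) h2 hcδ hy
    exact (abs_sub_le _ _ _).trans (add_le_add h1 h3)
  have hint : |∫ x in qx..(qx + δ), ((F (x, qy + δ) - F (x, qy)) / (qy + δ - qy) - D)| ≤
      M + δ * (M / (c * δ)) := by
    refine (abs_integral_le_integral_abs (by linarith)).trans ?_
    refine (integral_mono_on (by linarith)
      ((hGc.sub continuous_const).abs.intervalIntegrable _ _)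
      (Continuous.intervalIntegrable (by fun_prop) _ _) hpt).trans ?_
    rw [intervalIntegral.integral_add (hΦc.intervalIntegrable _ _)
      (continuous_const.intervalIntegrable _ _), intervalIntegral.integral_const, smul_eq_mul,
      add_sub_cancel_left]
    gcongr
    refine integral_mono_interval ha (by linarith) hb ?_ (hΦc.intervalIntegrable _ _)
    exact Filter.Eventually.of_forall fun u =>
      integral_nonneg (by linarith) fun r _ => norm_nonneg _
  rw [intervalIntegral.integral_sub (hGc.intervalIntegrable _ _)
    (continuous_const.intervalIntegrable _ _), intervalIntegral.integral_const, smul_eq_mul,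
    add_sub_cancel_left qx δ] at hint
  set I : ℝ := ∫ x in qx..(qx + δ), (F (x, qy + δ) - F (x, qy)) / (qy + δ - qy)
  calc |δ⁻¹ * I - D| = δ⁻¹ * |I - δ * D| := by
        rw [← abs_of_pos (inv_pos.2 hδ), ← abs_mul, abs_of_pos (inv_pos.2 hδ)]
        congr 1
        field_simp
    _ ≤ δ⁻¹ * (M + δ * (M / (c * δ))) := by gcongr
    _ = (1 + c⁻¹) * δ⁻¹ * M := by field_simp

/-- Jensen's inequality for averages of nonnegative functions on a bounded rectangle. -/
lemma rpow_average_le {f : ℝ × ℝ → ℝ} (hf : Continuous f) (hf0 : ∀ z, 0 ≤ f z)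
    {a b α β L q : ℝ} (hL : 0 < L) (hab : b - a = L) (hαβ : β - α = L) (hq : 1 ≤ q) :
    ((L ^ 2)⁻¹ * ∫ z in Set.Ioo a b ×ˢ Set.Ioo α β, f z) ^ q ≤
      (L ^ 2)⁻¹ * ∫ z in Set.Ioo a b ×ˢ Set.Ioo α β, f z ^ q := by
  set s := Set.Ioo a b ×ˢ Set.Ioo α β with hs
  have hvol : volume s = ENNReal.ofReal (L ^ 2) := by
    rw [hs, Measure.volume_eq_prod, Measure.prod_prod, Real.volume_Ioo, Real.volume_Ioo, hab, hαβ,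
      ← ENNReal.ofReal_mul hL.le, sq]
  have hreal : volume.real s = L ^ 2 := by
    rw [Measure.real, hvol, ENNReal.toReal_ofReal (by positivity)]
  have hsub : s ⊆ Set.Icc a b ×ˢ Set.Icc α β :=
    Set.prod_mono Set.Ioo_subset_Icc_self Set.Ioo_subset_Icc_self
  have hfq : Continuous fun z => f z ^ q :=
    hf.rpow_const fun _ => Or.inr (by linarith)
  have h := (convexOn_rpow hq).map_set_average_le (μ := volume) (t := s) (f := f)
    (Real.continuous_rpow_const (by linarith)).continuousOn isClosed_Ici
    (by rw [hvol]; simp [hL.ne']) (by rw [hvol]; simp)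
    (Filter.Eventually.of_forall hf0)
    ((integrableOn_Icc_prod_Icc hf a b α β).mono_set hsub)
    ((integrableOn_Icc_prod_Icc hfq a b α β).mono_set hsub)
  simpa only [setAverage_eq, hreal, smul_eq_mul] using h

/-- Let `1 < p < 2`, `p̃ = (1+p)/2`, `C > 1.1`, `c > 0`. There is `C_p`
depending only on `c`, `C`, `p` such that for every C² function `F`, every closed square
`Q` of side `δ > 0`, and all points `z₁ = (x₁,y₁), z₂ = (x₁,y₂) ∈ CQ` with
`|y₁ - y₂| ≥ c·δ`,
`δ^{2-p} |Av_Q ∂_y F - (F(z₂)-F(z₁))/(y₂-y₁)|^p ≤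
  C_p δ² ((1/|CQ|) ∫_{CQ} |∇²F|^{p̃})^{p/p̃}`. -/
theorem difference_quotient_y_estimate
    (p C c : ℝ) (hp1 : 1 < p) (hp2 : p < 2) (hC : 1.1 < C) (hc : 0 < c) :
    ∃ Cp : ℝ, 0 < Cp ∧
      ∀ (F : ℝ × ℝ → ℝ) (qx qy δ x₁ y₁ y₂ : ℝ), ContDiff ℝ 2 F → 0 < δ →
        ((x₁, y₁) ∈ openSq qx qy δ C) → ((x₁, y₂) ∈ openSq qx qy δ C) →
        c * δ ≤ |y₁ - y₂| →
        δ ^ (2 - p) *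
            |avDy F qx qy δ - (F (x₁, y₂) - F (x₁, y₁)) / (y₂ - y₁)| ^ p ≤
          Cp * δ ^ (2 : ℝ) *
            (((C * δ) ^ 2)⁻¹ *
                ∫ z in openSq qx qy δ C,
                  ‖iteratedFDeriv ℝ 2 F z‖ ^ ((1 + p) / 2)) ^ (p / ((1 + p) / 2)) := by
  set q : ℝ := (1 + p) / 2 with hq
  have hq1 : 1 ≤ q := by rw [hq]; linarith
  have hC1 : 1 < C := lt_trans (by norm_num) hC
  have hC0 : 0 < C := by linarith
  refine ⟨((1 + c⁻¹) * C ^ 2) ^ p, by positivity, ?_⟩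
  intro F qx qy δ x₁ y₁ y₂ hF hδ hz₁ hz₂ hy
  have hCδ : δ < C * δ := by nlinarith
  have hH := continuous_norm_iteratedFDeriv_two hF
  have hmain := abs_avDy_sub_slope_le hF (qx := qx) (qy := qy) hδ hc
    (by linarith) (by linarith) (by linarith) (by linarith)
    (Set.Ioo_subset_Icc_self hz₁.1) (Set.Ioo_subset_Icc_self hz₁.2)
    (Set.Ioo_subset_Icc_self hz₂.2) hy
  have hjensen := rpow_average_le hH (fun z => norm_nonneg _) (L := C * δ)
    (a := qx + δ / 2 - C * δ / 2) (b := qx + δ / 2 + C * δ / 2)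
    (α := qy + δ / 2 - C * δ / 2) (β := qy + δ / 2 + C * δ / 2)
    (by positivity) (by ring) (by ring) hq1
  rw [← openSq] at hmain hjensen
  set N : ℝ := ((C * δ) ^ 2)⁻¹ * ∫ z in openSq qx qy δ C, ‖iteratedFDeriv ℝ 2 F z‖ with hN
  set P : ℝ := ((C * δ) ^ 2)⁻¹ * ∫ z in openSq qx qy δ C, ‖iteratedFDeriv ℝ 2 F z‖ ^ q
  have hN0 : 0 ≤ N :=
    mul_nonneg (by positivity) (integral_nonneg fun z => norm_nonneg _)
  have hNP : N ^ p ≤ P ^ (p / q) := by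
    have h := Real.rpow_le_rpow (by positivity) hjensen (z := p / q) (by positivity)
    rwa [← Real.rpow_mul hN0, mul_div_cancel₀ p (by positivity)] at h
  have hdiff : |avDy F qx qy δ - (F (x₁, y₂) - F (x₁, y₁)) / (y₂ - y₁)| ≤
      (1 + c⁻¹) * C ^ 2 * δ * N := by
    refine hmain.trans_eq ?_
    rw [hN]
    field_simp
  calc δ ^ (2 - p) * |avDy F qx qy δ - (F (x₁, y₂) - F (x₁, y₁)) / (y₂ - y₁)| ^ p
      ≤ δ ^ (2 - p) * ((1 + c⁻¹) * C ^ 2 * δ * N) ^ p := by gcongr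
    _ = ((1 + c⁻¹) * C ^ 2) ^ p * δ ^ (2 : ℝ) * N ^ p := by
        rw [Real.mul_rpow (by positivity) hN0, Real.mul_rpow (by positivity) hδ.le,
          show (2 : ℝ) = (2 - p) + p by ring, Real.rpow_add hδ]
        ring_nf
    _ ≤ ((1 + c⁻¹) * C ^ 2) ^ p * δ ^ (2 : ℝ) * P ^ (p / q) := by gcongr
end

section
/- Let 1 < p < 2, p̃ = (1+p)/2, C > 1.1, and c > 0. Let F : ℝ² → ℝ be twice continuously differentiable. Let Q, Q₁, Q₂ ⊂ ℝ² be closed axis-parallel squares with Q₁ ⊆ CQ, Q₂ ⊆ CQ, and side lengths δ_{Q₁} ≥ c·δ_Q and δ_{Q₂} ≥ c·δ_Q. Then δ_Q^{2−p} · | Av_{Q₁} ∇F − Av_{Q₂} ∇F |^p ≤ C_p · δ_Q² · ( (1/|CQ|) ∫_{CQ} |∇²F(z)|^{p̃} dz )^{p/p̃}, where C_p depends only on c, C, and p. -/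
open MeasureTheory

/-- `Av_Q ∂_x F = (1/|Q|) ∫_Q ∂_x F`. -/
noncomputable def avDx (F : ℝ × ℝ → ℝ) (qx qy δ : ℝ) : ℝ :=
  (δ ^ 2)⁻¹ * ∫ z in closedSq qx qy δ, fderiv ℝ F z (1, 0)

/-- A C¹ function on an interval oscillates by at most the integral of a majorant of its
derivative. -/
lemma abs_sub_le_intervalIntegral_of_abs_deriv_le {f f' h : ℝ → ℝ} {a b x y : ℝ}
    (hf : ∀ t, HasDerivAt f (f' t) t) (hf' : Continuous f') (hh : Continuous h)
    (hle : ∀ t, |f' t| ≤ h t) (hx : x ∈ Set.Icc a b) (hy : y ∈ Set.Icc a b) :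
    |f x - f y| ≤ ∫ t in a..b, h t := by
  wlog hxy : y ≤ x generalizing x y
  · rw [abs_sub_comm]
    exact this hy hx (le_of_not_ge hxy)
  rw [← intervalIntegral.integral_eq_sub_of_hasDerivAt (fun t _ => hf t)
    (hf'.intervalIntegrable _ _)]
  calc |∫ t in y..x, f' t| ≤ ∫ t in y..x, |f' t| :=
        intervalIntegral.abs_integral_le_integral_abs hxy
    _ ≤ ∫ t in y..x, h t :=
        intervalIntegral.integral_mono_on hxy (hf'.abs.intervalIntegrable _ _)
          (hh.intervalIntegrable _ _) (fun t _ => hle t)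
    _ ≤ ∫ t in a..b, h t :=
        intervalIntegral.integral_mono_interval hy.1 hxy hx.2
          (Filter.Eventually.of_forall fun t => (abs_nonneg _).trans (hle t))
          (hh.intervalIntegrable _ _)

/-- If `g x - g y ≤ φ x + ψ y` for `x ∈ A`, `y ∈ B`, the same holds for the averages. -/
lemma setAverage_sub_le_of_forall_sub_le {α : Type*} [MeasurableSpace α] {μ : Measure α}
    {A B : Set α} {g φ ψ : α → ℝ} (hA : MeasurableSet A) (hB : MeasurableSet B)
    (hA0 : μ A ≠ 0) (hA' : μ A ≠ ⊤) (hB0 : μ B ≠ 0) (hB' : μ B ≠ ⊤)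
    (hgA : IntegrableOn g A μ) (hgB : IntegrableOn g B μ)
    (hφ : IntegrableOn φ A μ) (hψ : IntegrableOn ψ B μ)
    (h : ∀ x ∈ A, ∀ y ∈ B, g x - g y ≤ φ x + ψ y) :
    (⨍ x in A, g x ∂μ) - ⨍ y in B, g y ∂μ ≤ (⨍ x in A, φ x ∂μ) + ⨍ y in B, ψ y ∂μ := by
  have mA : 0 < μ.real A := ENNReal.toReal_pos hA0 hA'
  have mB : 0 < μ.real B := ENNReal.toReal_pos hB0 hB'
  simp only [setAverage_eq, smul_eq_mul]
  have step : ∀ y ∈ B, (μ.real A)⁻¹ * ((∫ x in A, g x ∂μ) - ∫ x in A, φ x ∂μ) ≤ g y + ψ y := by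
    intro y hy
    rw [inv_mul_le_iff₀ mA, ← integral_sub hgA hφ]
    calc ∫ x in A, (g x - φ x) ∂μ ≤ ∫ _ in A, (g y + ψ y) ∂μ :=
          setIntegral_mono_on (hgA.sub hφ) (integrableOn_const hA') hA
            (fun x hx => by linarith [h x hx y hy])
      _ = _ := by simp
  have : (μ.real A)⁻¹ * ((∫ x in A, g x ∂μ) - ∫ x in A, φ x ∂μ) ≤
      (μ.real B)⁻¹ * ((∫ y in B, g y ∂μ) + ∫ y in B, ψ y ∂μ) := by
    rw [le_inv_mul_iff₀ mB, ← integral_add hgB hψ]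
    calc _ = ∫ _ in B, (μ.real A)⁻¹ * ((∫ x in A, g x ∂μ) - ∫ x in A, φ x ∂μ) ∂μ := by simp
      _ ≤ _ := setIntegral_mono_on (integrableOn_const hB') (hgB.add hψ) hB step
  linarith [mul_sub (μ.real A)⁻¹ (∫ x in A, g x ∂μ) (∫ x in A, φ x ∂μ),
    mul_add (μ.real B)⁻¹ (∫ y in B, g y ∂μ) (∫ y in B, ψ y ∂μ)]

lemma isCompact_closedSq (qx qy δ : ℝ) : IsCompact (closedSq qx qy δ) :=
  isCompact_Icc.prod isCompact_Icc

lemma volume_real_closedSq {qx qy δ : ℝ} (hδ : 0 < δ) :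
    volume.real (closedSq qx qy δ) = δ ^ 2 := by
  rw [closedSq, Measure.volume_eq_prod, measureReal_prod_prod]
  simp [hδ.le, sq]

lemma volume_closedSq_ne_zero {qx qy δ : ℝ} (hδ : 0 < δ) : volume (closedSq qx qy δ) ≠ 0 := by
  intro h
  have := volume_real_closedSq (qx := qx) (qy := qy) hδ
  rw [Measure.real, h, ENNReal.toReal_zero] at this
  exact (pow_pos hδ 2).ne this

/-- An oscillation estimate for averages over two squares inside a rectangle of a function whose
partial derivatives are dominated by `H`. -/
lemma setAverage_sub_le_integral_of_abs_partial_le {g H : ℝ × ℝ → ℝ} (hg : ContDiff ℝ 1 g)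
    (hH : Continuous H) (h1 : ∀ z, |fderiv ℝ g z (1, 0)| ≤ H z)
    (h2 : ∀ z, |fderiv ℝ g z (0, 1)| ≤ H z) {a b a' b' q1x q1y δ₁ q2x q2y δ₂ : ℝ}
    (hδ₁ : 0 < δ₁) (hδ₂ : 0 < δ₂)
    (hs₁ : closedSq q1x q1y δ₁ ⊆ Set.Icc a b ×ˢ Set.Icc a' b')
    (hs₂ : closedSq q2x q2y δ₂ ⊆ Set.Icc a b ×ˢ Set.Icc a' b') :
    (⨍ z in closedSq q1x q1y δ₁, g z) - ⨍ z in closedSq q2x q2y δ₂, g z ≤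
      (δ₁⁻¹ + δ₂⁻¹) * ∫ z in Set.Icc a b ×ˢ Set.Icc a' b', H z := by
  have hdiff : Differentiable ℝ g := hg.differentiable one_ne_zero
  have hfd : Continuous (fderiv ℝ g) := hg.continuous_fderiv one_ne_zero
  have hH0 : ∀ z, 0 ≤ H z := fun z => (abs_nonneg _).trans (h1 z)
  set Φ : ℝ → ℝ := fun v => ∫ t in a..b, H (t, v) with hΦ
  set Ψ : ℝ → ℝ := fun u => ∫ s in a'..b', H (u, s) with hΨ
  have hΦc : Continuous Φ :=
    intervalIntegral.continuous_parametric_intervalIntegral_of_continuous' (by fun_prop) a b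
  have hΨc : Continuous Ψ :=
    intervalIntegral.continuous_parametric_intervalIntegral_of_continuous' (by fun_prop) a' b'
  have hmem₁ := hs₁ (show (q1x, q1y) ∈ closedSq q1x q1y δ₁ by simp [closedSq, hδ₁.le])
  have hab : a ≤ b := hmem₁.1.1.trans hmem₁.1.2
  have hab' : a' ≤ b' := hmem₁.2.1.trans hmem₁.2.2
  have hΦ0 : ∀ v, 0 ≤ Φ v := fun v => intervalIntegral.integral_nonneg hab fun _ _ => hH0 _
  have hΨ0 : ∀ u, 0 ≤ Ψ u := fun u => intervalIntegral.integral_nonneg hab' fun _ _ => hH0 _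
  have hHint : IntegrableOn H (Set.Icc a b ×ˢ Set.Icc a' b') :=
    hH.continuousOn.integrableOn_compact (isCompact_Icc.prod isCompact_Icc)
  have hΨint : ∫ u in Set.Icc a b, Ψ u = ∫ z in Set.Icc a b ×ˢ Set.Icc a' b', H z := by
    rw [Measure.volume_eq_prod, setIntegral_prod _ hHint]
    simp only [hΨ, intervalIntegral.integral_of_le hab', integral_Icc_eq_integral_Ioc]
  have hΦint : ∫ v in Set.Icc a' b', Φ v = ∫ z in Set.Icc a b ×ˢ Set.Icc a' b', H z := by
    rw [← hΨint]
    simp only [hΨ, hΦ, intervalIntegral.integral_of_le hab', intervalIntegral.integral_of_le hab,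
      ← integral_Icc_eq_integral_Ioc]
    refine (integral_integral_swap (f := fun x y => H (x, y)) ?_).symm
    rw [Measure.prod_restrict]
    exact hHint
  have key := setAverage_sub_le_of_forall_sub_le (μ := volume) (g := g)
    (φ := fun z => Φ z.2) (ψ := fun z => Ψ z.1)
    (isCompact_closedSq q1x q1y δ₁).measurableSet (isCompact_closedSq q2x q2y δ₂).measurableSet
    (volume_closedSq_ne_zero hδ₁) (isCompact_closedSq _ _ _).measure_ne_top
    (volume_closedSq_ne_zero hδ₂) (isCompact_closedSq _ _ _).measure_ne_top
    (hg.continuous.continuousOn.integrableOn_compact (isCompact_closedSq _ _ _))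
    (hg.continuous.continuousOn.integrableOn_compact (isCompact_closedSq _ _ _))
    ((hΦc.comp continuous_snd).continuousOn.integrableOn_compact (isCompact_closedSq _ _ _))
    ((hΨc.comp continuous_fst).continuousOn.integrableOn_compact (isCompact_closedSq _ _ _))
    (by
      intro x hx y hy
      have e1 : |g (x.1, x.2) - g (y.1, x.2)| ≤ Φ x.2 :=
        abs_sub_le_intervalIntegral_of_abs_deriv_le (f := fun t => g (t, x.2))
          (f' := fun t => fderiv ℝ g (t, x.2) (1, 0)) (h := fun t => H (t, x.2))
          (fun t => (hdiff (t, x.2)).hasFDerivAt.comp_hasDerivAt t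
            ((hasDerivAt_id t).prodMk (hasDerivAt_const t x.2)))
          (by fun_prop) (by fun_prop) (fun t => h1 _) (hs₁ hx).1 (hs₂ hy).1
      have e2 : |g (y.1, x.2) - g (y.1, y.2)| ≤ Ψ y.1 :=
        abs_sub_le_intervalIntegral_of_abs_deriv_le (f := fun t => g (y.1, t))
          (f' := fun t => fderiv ℝ g (y.1, t) (0, 1)) (h := fun t => H (y.1, t))
          (fun t => (hdiff (y.1, t)).hasFDerivAt.comp_hasDerivAt t
            ((hasDerivAt_const t y.1).prodMk (hasDerivAt_id t)))
          (by fun_prop) (by fun_prop) (fun t => h2 _) (hs₁ hx).2 (hs₂ hy).2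
      have := (abs_le.1 e1).2
      have := (abs_le.1 e2).2
      show g (x.1, x.2) - g (y.1, y.2) ≤ _
      linarith)
  refine key.trans ?_
  rw [add_mul]
  refine add_le_add ?_ ?_
  · rw [setAverage_eq, volume_real_closedSq hδ₁, smul_eq_mul, closedSq, Measure.volume_eq_prod]
    have e := setIntegral_prod_mul (μ := volume) (ν := volume) (fun _ : ℝ => (1 : ℝ)) Φ
      (Set.Icc q1x (q1x + δ₁)) (Set.Icc q1y (q1y + δ₁))
    simp only [one_mul] at e
    rw [e]
    have hsub : Set.Icc q1y (q1y + δ₁) ⊆ Set.Icc a' b' := fun v hv =>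
      (hs₁ (show (q1x, v) ∈ closedSq q1x q1y δ₁ from ⟨by simp [hδ₁.le], hv⟩)).2
    have hle : ∫ v in Set.Icc q1y (q1y + δ₁), Φ v ≤ ∫ v in Set.Icc a' b', Φ v :=
      setIntegral_mono_set (hΦc.continuousOn.integrableOn_compact isCompact_Icc)
        (Filter.Eventually.of_forall hΦ0) hsub.eventuallyLE
    rw [hΦint, Measure.volume_eq_prod] at hle
    calc _ = δ₁⁻¹ * ∫ v in Set.Icc q1y (q1y + δ₁), Φ v := by
          simp [hδ₁.le]; field_simp
      _ ≤ _ := by gcongr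
  · rw [setAverage_eq, volume_real_closedSq hδ₂, smul_eq_mul, closedSq, Measure.volume_eq_prod]
    have e := setIntegral_prod_mul (μ := volume) (ν := volume) Ψ (fun _ : ℝ => (1 : ℝ))
      (Set.Icc q2x (q2x + δ₂)) (Set.Icc q2y (q2y + δ₂))
    simp only [mul_one] at e
    rw [e]
    have hsub : Set.Icc q2x (q2x + δ₂) ⊆ Set.Icc a b := fun v hv =>
      (hs₂ (show (v, q2y) ∈ closedSq q2x q2y δ₂ from ⟨hv, by simp [hδ₂.le]⟩)).1
    have hle : ∫ v in Set.Icc q2x (q2x + δ₂), Ψ v ≤ ∫ v in Set.Icc a b, Ψ v :=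
      setIntegral_mono_set (hΨc.continuousOn.integrableOn_compact isCompact_Icc)
        (Filter.Eventually.of_forall hΨ0) hsub.eventuallyLE
    rw [hΨint, Measure.volume_eq_prod] at hle
    calc _ = δ₂⁻¹ * ∫ v in Set.Icc q2x (q2x + δ₂), Ψ v := by
          simp [hδ₂.le]; field_simp
      _ ≤ _ := by gcongr

/-- The Hessian norm dominates the derivatives of a directional derivative. -/
lemma abs_fderiv_fderiv_apply_le {E : Type*} [NormedAddCommGroup E] [NormedSpace ℝ E]
    {F : E → ℝ} (hF : ContDiff ℝ 2 F) {e v : E} (he : ‖e‖ ≤ 1) (hv : ‖v‖ ≤ 1) (z : E) :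
    |fderiv ℝ (fun w => fderiv ℝ F w e) z v| ≤ ‖iteratedFDeriv ℝ 2 F z‖ := by
  have hd : DifferentiableAt ℝ (fderiv ℝ F) z :=
    ((hF.fderiv_right (m := 1) (by norm_num)).differentiable one_ne_zero) z
  have h1 : fderiv ℝ (fun w => fderiv ℝ F w e) z v = iteratedFDeriv ℝ 2 F z ![v, e] := by
    rw [iteratedFDeriv_two_apply, fderiv_clm_apply hd (differentiableAt_const e)]
    simp
  rw [h1, ← Real.norm_eq_abs]
  refine ((iteratedFDeriv ℝ 2 F z).le_opNorm _).trans (mul_le_of_le_one_right (norm_nonneg _) ?_)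
  simpa using mul_le_one₀ hv (norm_nonneg _) he

/-- Jensen's inequality for powers on an open square. -/
lemma average_openSq_le_rpow {H : ℝ × ℝ → ℝ} (hH : Continuous H) (hH0 : ∀ z, 0 ≤ H z)
    {r C δ : ℝ} (hr : 1 ≤ r) (hC : 0 < C) (hδ : 0 < δ) (qx qy : ℝ) :
    ((C * δ) ^ 2)⁻¹ * ∫ z in openSq qx qy δ C, H z ≤
      (((C * δ) ^ 2)⁻¹ * ∫ z in openSq qx qy δ C, H z ^ r) ^ r⁻¹ := by
  have hCδ : 0 < C * δ := mul_pos hC hδ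
  have hr0 : 0 < r := by linarith
  have hvol : volume.real (openSq qx qy δ C) = (C * δ) ^ 2 := by
    rw [openSq, Measure.volume_eq_prod, measureReal_prod_prod]
    rw [Real.volume_real_Ioo_of_le (by linarith), Real.volume_real_Ioo_of_le (by linarith)]
    ring
  have hint : ∀ G : ℝ × ℝ → ℝ, Continuous G → IntegrableOn G (openSq qx qy δ C) := fun G hG =>
    (hG.continuousOn.integrableOn_compact (isCompact_Icc.prod isCompact_Icc)).mono_set
      (Set.prod_mono Set.Ioo_subset_Icc_self Set.Ioo_subset_Icc_self)
  have h0 : volume (openSq qx qy δ C) ≠ 0 := by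
    intro h
    rw [Measure.real, h, ENNReal.toReal_zero] at hvol
    exact (pow_pos hCδ 2).ne hvol
  have htop : volume (openSq qx qy δ C) ≠ ⊤ := by
    intro h
    rw [Measure.real, h, ENNReal.toReal_top] at hvol
    exact (pow_pos hCδ 2).ne hvol
  have J := (convexOn_rpow hr).map_set_average_le
    (continuousOn_id.rpow_const fun _ _ => Or.inr hr0.le) isClosed_Ici h0 htop
    (Filter.Eventually.of_forall fun z => hH0 z) (hint H hH)
    (hint _ (hH.rpow_const fun _ => Or.inr hr0.le))
  simp only [setAverage_eq, smul_eq_mul, hvol] at J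
  have hnn : 0 ≤ ((C * δ) ^ 2)⁻¹ * ∫ z in openSq qx qy δ C, H z :=
    mul_nonneg (by positivity) (integral_nonneg fun z => hH0 z)
  calc _ = ((((C * δ) ^ 2)⁻¹ * ∫ z in openSq qx qy δ C, H z) ^ r) ^ r⁻¹ :=
        (Real.rpow_rpow_inv hnn hr0.ne').symm
    _ ≤ _ := Real.rpow_le_rpow (Real.rpow_nonneg hnn _) J (by positivity)

/-- Averages over two squares inside `openSq` of a directional derivative differ by at most a
multiple of the integral of the Hessian norm. -/
lemma abs_average_fderiv_sub_le {F : ℝ × ℝ → ℝ} (hF : ContDiff ℝ 2 F) {e : ℝ × ℝ} (he : ‖e‖ ≤ 1)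
    {c C qx qy δ q1x q1y δ₁ q2x q2y δ₂ : ℝ} (hc : 0 < c) (hδ : 0 < δ)
    (hδ₁ : 0 < δ₁) (hδ₂ : 0 < δ₂)
    (hs₁ : closedSq q1x q1y δ₁ ⊆ openSq qx qy δ C)
    (hs₂ : closedSq q2x q2y δ₂ ⊆ openSq qx qy δ C)
    (hc₁ : c * δ ≤ δ₁) (hc₂ : c * δ ≤ δ₂) :
    |((δ₁ ^ 2)⁻¹ * ∫ z in closedSq q1x q1y δ₁, fderiv ℝ F z e) -
      (δ₂ ^ 2)⁻¹ * ∫ z in closedSq q2x q2y δ₂, fderiv ℝ F z e| ≤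
      2 * (c * δ)⁻¹ * ∫ z in openSq qx qy δ C, ‖iteratedFDeriv ℝ 2 F z‖ := by
  have hcδ : 0 < c * δ := mul_pos hc hδ
  have hg : ContDiff ℝ 1 (fun w => fderiv ℝ F w e) :=
    (hF.fderiv_right (m := 1) (by norm_num)).clm_apply contDiff_const
  have hH : Continuous fun z => ‖iteratedFDeriv ℝ 2 F z‖ :=
    (hF.continuous_iteratedFDeriv le_rfl).norm
  have hI : ∫ z in Set.Icc (qx + δ / 2 - C * δ / 2) (qx + δ / 2 + C * δ / 2) ×ˢ
      Set.Icc (qy + δ / 2 - C * δ / 2) (qy + δ / 2 + C * δ / 2), ‖iteratedFDeriv ℝ 2 F z‖ =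
      ∫ z in openSq qx qy δ C, ‖iteratedFDeriv ℝ 2 F z‖ :=
    (setIntegral_congr_set (Measure.set_prod_ae_eq Ioo_ae_eq_Icc Ioo_ae_eq_Icc)).symm
  have hsub : openSq qx qy δ C ⊆
      Set.Icc (qx + δ / 2 - C * δ / 2) (qx + δ / 2 + C * δ / 2) ×ˢ
        Set.Icc (qy + δ / 2 - C * δ / 2) (qy + δ / 2 + C * δ / 2) :=
    Set.prod_mono Set.Ioo_subset_Icc_self Set.Ioo_subset_Icc_self
  have hx : ‖((1 : ℝ), (0 : ℝ))‖ ≤ 1 := by simp [Prod.norm_def]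
  have hy : ‖((0 : ℝ), (1 : ℝ))‖ ≤ 1 := by simp [Prod.norm_def]
  have k₁ := setAverage_sub_le_integral_of_abs_partial_le hg hH
    (abs_fderiv_fderiv_apply_le hF he hx) (abs_fderiv_fderiv_apply_le hF he hy) hδ₁ hδ₂
    (hs₁.trans hsub) (hs₂.trans hsub)
  have k₂ := setAverage_sub_le_integral_of_abs_partial_le hg hH
    (abs_fderiv_fderiv_apply_le hF he hx) (abs_fderiv_fderiv_apply_le hF he hy) hδ₂ hδ₁
    (hs₂.trans hsub) (hs₁.trans hsub)
  rw [add_comm δ₂⁻¹] at k₂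
  simp only [setAverage_eq, smul_eq_mul, volume_real_closedSq hδ₁, volume_real_closedSq hδ₂,
    hI] at k₁ k₂
  refine (abs_sub_le_iff.2 ⟨k₁, k₂⟩).trans ?_
  have hnn : 0 ≤ ∫ z in openSq qx qy δ C, ‖iteratedFDeriv ℝ 2 F z‖ :=
    integral_nonneg fun _ => norm_nonneg _
  refine mul_le_mul_of_nonneg_right ?_ hnn
  have := inv_anti₀ hcδ hc₁
  have := inv_anti₀ hcδ hc₂
  linarith

/-- Let `1 < p < 2`, `p̃ = (1+p)/2`, `C > 1.1`, `c > 0`. There is `C_p`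
depending only on `c`, `C`, `p` such that for every C² function `F` and all closed squares
`Q, Q₁, Q₂` with `Q₁, Q₂ ⊆ CQ` and `δ_{Q₁}, δ_{Q₂} ≥ c·δ_Q`,
`δ_Q^{2-p} |Av_{Q₁} ∇F - Av_{Q₂} ∇F|^p ≤
  C_p δ_Q² ((1/|CQ|) ∫_{CQ} |∇²F|^{p̃})^{p/p̃}`,
where `|·|` is the Euclidean norm on ℝ². -/
theorem averaged_gradient_comparison
    (p C c : ℝ) (hp1 : 1 < p) (hp2 : p < 2) (hC : 1.1 < C) (hc : 0 < c) :
    ∃ Cp : ℝ, 0 < Cp ∧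
      ∀ (F : ℝ × ℝ → ℝ) (qx qy δ q1x q1y δ₁ q2x q2y δ₂ : ℝ), ContDiff ℝ 2 F →
        0 < δ → 0 < δ₁ → 0 < δ₂ →
        closedSq q1x q1y δ₁ ⊆ openSq qx qy δ C →
        closedSq q2x q2y δ₂ ⊆ openSq qx qy δ C →
        c * δ ≤ δ₁ → c * δ ≤ δ₂ →
        δ ^ (2 - p) *
            (Real.sqrt ((avDx F q1x q1y δ₁ - avDx F q2x q2y δ₂) ^ 2 +
                (avDy F q1x q1y δ₁ - avDy F q2x q2y δ₂) ^ 2)) ^ p ≤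
          Cp * δ ^ (2 : ℝ) *
            (((C * δ) ^ 2)⁻¹ *
                ∫ z in openSq qx qy δ C,
                  ‖iteratedFDeriv ℝ 2 F z‖ ^ ((1 + p) / 2)) ^ (p / ((1 + p) / 2)) := by
  have hC0 : 0 < C := by linarith
  refine ⟨(4 * C ^ 2 / c) ^ p, by positivity, ?_⟩
  intro F qx qy δ q1x q1y δ₁ q2x q2y δ₂ hF hδ hδ₁ hδ₂ hs₁ hs₂ hc₁ hc₂
  have hx := abs_average_fderiv_sub_le hF (e := (1, 0)) (by simp [Prod.norm_def])
    hc hδ hδ₁ hδ₂ hs₁ hs₂ hc₁ hc₂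
  have hy := abs_average_fderiv_sub_le hF (e := (0, 1)) (by simp [Prod.norm_def])
    hc hδ hδ₁ hδ₂ hs₁ hs₂ hc₁ hc₂
  rw [← avDx, ← avDx] at hx
  rw [← avDy, ← avDy] at hy
  have hJ := average_openSq_le_rpow (hF.continuous_iteratedFDeriv le_rfl).norm
    (fun _ => norm_nonneg _) (r := (1 + p) / 2) (by linarith) hC0 hδ qx qy
  set A := ((C * δ) ^ 2)⁻¹ * ∫ z in openSq qx qy δ C, ‖iteratedFDeriv ℝ 2 F z‖ ^ ((1 + p) / 2)
    with hA
  have hA0 : 0 ≤ A :=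
    mul_nonneg (by positivity) (integral_nonneg fun _ => Real.rpow_nonneg (norm_nonneg _) _)
  set I := ∫ z in openSq qx qy δ C, ‖iteratedFDeriv ℝ 2 F z‖
  rw [inv_mul_le_iff₀ (by positivity)] at hJ
  set X := avDx F q1x q1y δ₁ - avDx F q2x q2y δ₂
  set Y := avDy F q1x q1y δ₁ - avDy F q2x q2y δ₂
  have hnorm : Real.sqrt (X ^ 2 + Y ^ 2) ≤ 4 * C ^ 2 / c * δ * A ^ ((1 + p) / 2)⁻¹ :=
    calc Real.sqrt (X ^ 2 + Y ^ 2) ≤ |X| + |Y| := by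
          rw [Real.sqrt_le_left (by positivity), ← sq_abs X, ← sq_abs Y]
          nlinarith [abs_nonneg X, abs_nonneg Y]
      _ ≤ 4 * (c * δ)⁻¹ * I := by linarith
      _ ≤ 4 * (c * δ)⁻¹ * ((C * δ) ^ 2 * A ^ ((1 + p) / 2)⁻¹) := by gcongr
      _ = _ := by field_simp
  calc _ ≤ δ ^ (2 - p) * (4 * C ^ 2 / c * δ * A ^ ((1 + p) / 2)⁻¹) ^ p := by gcongr
    _ = (4 * C ^ 2 / c) ^ p * (δ ^ (2 - p) * δ ^ p) * A ^ (p / ((1 + p) / 2)) := by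
      rw [Real.mul_rpow (by positivity) (by positivity), Real.mul_rpow (by positivity) hδ.le,
        ← Real.rpow_mul hA0, inv_mul_eq_div]
      ring
    _ = _ := by rw [← Real.rpow_add hδ, sub_add_cancel]
end

section
/- Let I be a shadow of a Calderón–Zygmund square. Then there is at most one x* ∈ Ē⁺ with I ∈ Gp(x*). If, in addition, K ≥ 41 and I is a hard relevant shadow, then there exists x* ∈ Ē⁺ such that I ∈ Gp(x*). -/
/-- An axis-parallel square, recorded by its lower-left corner `(x, y)` and side length `s`. -/
structure Sq where
  x : ℝ
  y : ℝ
  s : ℝ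

namespace Sq

/-- The (closed) square as a subset of ℝ². -/
def set (Q : Sq) : Set (ℝ × ℝ) :=
  Set.Icc Q.x (Q.x + Q.s) ×ˢ Set.Icc Q.y (Q.y + Q.s)

/-- `Q.dilate C` is the *open* axis-parallel square `CQ` with the same center as `Q` and
side length `C·δ_Q`. -/
def dilate (Q : Sq) (C : ℝ) : Set (ℝ × ℝ) :=
  Set.Ioo (Q.x + Q.s / 2 - C * Q.s / 2) (Q.x + Q.s / 2 + C * Q.s / 2) ×ˢ
    Set.Ioo (Q.y + Q.s / 2 - C * Q.s / 2) (Q.y + Q.s / 2 + C * Q.s / 2)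

/-- Dyadic squares: `Q⁰ = [-1,1]²` and all closed squares obtained from `Q⁰` by successive
bisection, i.e. `[i·2^{-k}, (i+1)·2^{-k}] × [j·2^{-k}, (j+1)·2^{-k}]` with
`i, j ∈ {-2^k, …, 2^k - 1}`. -/
def IsDyadic (Q : Sq) : Prop :=
  (Q.x = -1 ∧ Q.y = -1 ∧ Q.s = 2) ∨
    ∃ (k : ℕ) (i j : ℤ), -(2 ^ k : ℤ) ≤ i ∧ i < 2 ^ k ∧ -(2 ^ k : ℤ) ≤ j ∧ j < 2 ^ k ∧
      Q.x = (i : ℝ) * (2 : ℝ) ^ (-(k : ℤ)) ∧ Q.y = (j : ℝ) * (2 : ℝ) ^ (-(k : ℤ)) ∧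
      Q.s = (2 : ℝ) ^ (-(k : ℤ))

end Sq

/-- A closed interval, recorded by its left endpoint `a` and length `len`. -/
structure Iv where
  a : ℝ
  len : ℝ

namespace Iv

/-- The (closed) interval as a subset of ℝ. -/
def set (I : Iv) : Set ℝ := Set.Icc I.a (I.a + I.len)

/-- `I.dil C` is the *open* interval `CI` with the same center as `I` and length `C·|I|`. -/
def dil (I : Iv) (C : ℝ) : Set ℝ :=
  Set.Ioo (I.a + I.len / 2 - C * I.len / 2) (I.a + I.len / 2 + C * I.len / 2)

/-- Dyadic intervals: `I⁰ = [-1,1]` and all closed intervals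
`[i·2^{-k}, (i+1)·2^{-k}]` with `i ∈ {-2^k, …, 2^k - 1}`, obtained from `I⁰` by
successive bisection. -/
def IsDyadic (I : Iv) : Prop :=
  (I.a = -1 ∧ I.len = 2) ∨
    ∃ (k : ℕ) (i : ℤ), -(2 ^ k : ℤ) ≤ i ∧ i < 2 ^ k ∧
      I.a = (i : ℝ) * (2 : ℝ) ^ (-(k : ℤ)) ∧ I.len = (2 : ℝ) ^ (-(k : ℤ))

end Iv

/-- `E = Ē × {0} ⊂ ℝ²`. -/
def Eset (Ebar : Finset ℝ) : Set (ℝ × ℝ) := {z | z.1 ∈ Ebar ∧ z.2 = 0}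

/-- The hypotheses on the finite set `Ē ⊂ ℝ`: `#Ē ≥ 2` (so `N = #E ≥ 2`),
`max Ē = 2^{-11}` and `min Ē = -2^{-11}`. -/
def EbarHyp (Ebar : Finset ℝ) : Prop :=
  2 ≤ Ebar.card ∧ (2 : ℝ) ^ (-(11 : ℤ)) ∈ Ebar ∧ -(2 : ℝ) ^ (-(11 : ℤ)) ∈ Ebar ∧
    ∀ x ∈ Ebar, -(2 : ℝ) ^ (-(11 : ℤ)) ≤ x ∧ x ≤ (2 : ℝ) ^ (-(11 : ℤ))

/-- The Calderón–Zygmund collection `CZ`: the maximal dyadic squares `Q` such that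
`#(E ∩ 3Q) ≤ 1` (where `3Q` is the open concentric dilation). -/
def CZ (Ebar : Finset ℝ) (Q : Sq) : Prop :=
  Q.IsDyadic ∧ (Eset Ebar ∩ Q.dilate 3).Subsingleton ∧
    ∀ Q' : Sq, Q'.IsDyadic → (Eset Ebar ∩ Q'.dilate 3).Subsingleton →
      Q.set ⊆ Q'.set → Q.set = Q'.set

/-- The shadow `π(Q)` of a square `Q`, where `π(x,y) = x`. -/
def shadow (Q : Sq) : Iv := ⟨Q.x, Q.s⟩

/-- `Ē⁺ = Ē ∪ {-1}`. -/
noncomputable def EbarPlus (Ebar : Finset ℝ) : Finset ℝ := insert (-1) Ebar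

/-- `I` is a shadow of some CZ square. -/
def IsShadow (Ebar : Finset ℝ) (I : Iv) : Prop :=
  ∃ Q : Sq, CZ Ebar Q ∧ shadow Q = I

/-- The group `Gp(x*)`: the set of shadows `I` of CZ squares such that
(a) `x* ≤ inf 41I` (note `inf 41I = I.a - 20·|I|`), and
(b) `Ē⁺ ∩ (x*, inf 9I] = ∅` (note `inf 9I = I.a - 4·|I|`). -/
def Gp (Ebar : Finset ℝ) (xstar : ℝ) (I : Iv) : Prop :=
  IsShadow Ebar I ∧ xstar ≤ I.a - 20 * I.len ∧
    ∀ x ∈ EbarPlus Ebar, ¬(xstar < x ∧ x ≤ I.a - 4 * I.len)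

/-- A shadow `I` is *easy* (for the parameter `K`) if `diam(Ē⁺ ∩ KI) ≥ K⁻¹·|I|`. -/
def EasyShadow (Ebar : Finset ℝ) (K : ℝ) (I : Iv) : Prop :=
  ∃ u ∈ EbarPlus Ebar, ∃ v ∈ EbarPlus Ebar,
    u ∈ I.dil K ∧ v ∈ I.dil K ∧ K⁻¹ * I.len ≤ |u - v|

/-- The square `Q_inner = [-2^{-10}, 2^{-10}]²`. -/
def Qinner : Set (ℝ × ℝ) :=
  Set.Icc (-(2 : ℝ) ^ (-(10 : ℤ))) ((2 : ℝ) ^ (-(10 : ℤ))) ×ˢ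
    Set.Icc (-(2 : ℝ) ^ (-(10 : ℤ))) ((2 : ℝ) ^ (-(10 : ℤ)))

/-- A CZ square is *relevant* if `1.1Q ∩ Q_inner ≠ ∅`. -/
def Relevant (Ebar : Finset ℝ) (Q : Sq) : Prop :=
  CZ Ebar Q ∧ (Q.dilate 1.1 ∩ Qinner).Nonempty

theorem CZ.side_pos {Ebar : Finset ℝ} {Q : Sq} (hQ : CZ Ebar Q) : 0 < Q.s := by
  rcases hQ.1 with ⟨-, -, h⟩ | ⟨k, i, j, -, -, -, -, -, -, h⟩ <;> rw [h] <;> positivity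

/-- Every dyadic square of side less than `1` lies in a dyadic square of twice the side. -/
theorem Sq.IsDyadic.exists_parent {Q : Sq} (hQ : Q.IsDyadic) (hs : Q.s < 1) :
    ∃ P : Sq, P.IsDyadic ∧ P.s = 2 * Q.s ∧ P.x ≤ Q.x ∧ Q.x ≤ P.x + Q.s ∧
      P.y ≤ Q.y ∧ Q.y ≤ P.y + Q.s := by
  rcases hQ with ⟨-, -, h⟩ | ⟨k, i, j, hi₁, hi₂, hj₁, hj₂, hx, hy, h⟩
  · linarith
  rcases k with _ | m
  · norm_num at h
    linarith
  have hz : (2 : ℝ) ^ (-(m : ℤ)) = 2 * (2 : ℝ) ^ (-((m + 1 : ℕ) : ℤ)) := by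
    rw [← zpow_one_add₀ (by norm_num)]
    push_cast
    congr 1
    ring
  rw [pow_succ] at hi₁ hi₂ hj₁ hj₂
  have hpos : 0 < (2 : ℝ) ^ (-((m + 1 : ℕ) : ℤ)) := by positivity
  have half (n : ℤ) : ((2 * (n / 2) : ℤ) : ℝ) ≤ n ∧ (n : ℝ) ≤ ((2 * (n / 2) + 1 : ℤ) : ℝ) :=
    ⟨by exact_mod_cast (by omega), by exact_mod_cast (by omega)⟩
  have hi := half i
  have hj := half j
  push_cast at hi hj
  refine ⟨⟨(i / 2 : ℤ) * (2 : ℝ) ^ (-(m : ℤ)), (j / 2 : ℤ) * (2 : ℝ) ^ (-(m : ℤ)),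
    (2 : ℝ) ^ (-(m : ℤ))⟩, Or.inr ⟨m, i / 2, j / 2, by omega, by omega, by omega, by omega,
    rfl, rfl, rfl⟩, ?_, ?_, ?_, ?_, ?_⟩ <;> simp only [hx, hy, h, hz] <;> nlinarith

theorem CZ.exists_mem_near {Ebar : Finset ℝ} {Q : Sq} (hQ : CZ Ebar Q) (hs : Q.s < 1) :
    ∃ x ∈ Ebar, Q.x - 3 * Q.s < x ∧ x < Q.x + 4 * Q.s := by
  have hpos := hQ.side_pos
  obtain ⟨P, hP, hPs, hx₁, hx₂, hy₁, hy₂⟩ := hQ.1.exists_parent hs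
  by_contra! hno
  have hempty : (Eset Ebar ∩ P.dilate 3).Subsingleton := by
    rintro z ⟨hz, hzP⟩
    obtain ⟨⟨h₁, h₂⟩, -⟩ := hzP
    linarith [hno z.1 hz.1 (by linarith)]
  have heq := hQ.2.2 P hP hempty (Set.prod_mono
    (Set.Icc_subset_Icc hx₁ (by linarith)) (Set.Icc_subset_Icc hy₁ (by linarith)))
  have hlow : (P.x, P.y) ∈ Q.set :=
    heq ▸ ⟨⟨le_rfl, by simp only; linarith⟩, ⟨le_rfl, by simp only; linarith⟩⟩
  have hupp : (P.x + P.s, P.y + P.s) ∈ Q.set :=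
    heq ▸ ⟨⟨by simp only; linarith, le_rfl⟩, ⟨by simp only; linarith, le_rfl⟩⟩
  linarith [hlow.1.1, hupp.1.2]

/-- A large dyadic coordinate interval whose `1.1`-dilate comes close to the origin has the
origin as an endpoint. -/
theorem int_mem_of_dilate_near_zero {i : ℤ} {s z : ℝ} (hs : 1 / 4 ≤ s)
    (hz₁ : -(1 / 1024) ≤ z) (hz₂ : z ≤ 1 / 1024)
    (h₁ : i * s + s / 2 - 1.1 * s / 2 < z) (h₂ : z < i * s + s / 2 + 1.1 * s / 2) :
    -1 ≤ (i : ℝ) ∧ (i : ℝ) ≤ 0 := by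
  have hi₁ : (-2 : ℝ) < i := by
    by_contra! h
    nlinarith
  have hi₂ : (i : ℝ) < 1 := by
    by_contra! h
    nlinarith
  have hi₁' : -2 < i := by exact_mod_cast hi₁
  have hi₂' : i < 1 := by exact_mod_cast hi₂
  exact ⟨by exact_mod_cast (by omega : -1 ≤ i), by exact_mod_cast (by omega : i ≤ 0)⟩

theorem Relevant.side_le {Ebar : Finset ℝ} (hE : EbarHyp Ebar) {Q : Sq}
    (hQ : Relevant Ebar Q) : Q.s ≤ 1 / 8 := by
  obtain ⟨hCZ, ⟨u, v⟩, ⟨⟨hu₁, hu₂⟩, ⟨hv₁, hv₂⟩⟩, ⟨⟨hu₃, hu₄⟩, ⟨hv₃, hv₄⟩⟩⟩ := hQ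
  by_contra! hs
  norm_num only at hu₃ hu₄ hv₃ hv₄
  have hsmall : ¬ (Q.x - Q.s < -(1 / 2048) ∧ 1 / 2048 < Q.x + 2 * Q.s ∧
      Q.y - Q.s < 0 ∧ 0 < Q.y + 2 * Q.s) := by
    rintro ⟨h₁, h₂, h₃, h₄⟩
    have hmem (x : ℝ) (hx : x ∈ Ebar) : (x, (0 : ℝ)) ∈ Eset Ebar ∩ Q.dilate 3 := by
      have hb := hE.2.2.2 x hx
      norm_num only at hb
      exact ⟨⟨hx, rfl⟩, ⟨by simp only; linarith [hb.1], by simp only; linarith [hb.2]⟩,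
        ⟨by simp only; linarith, by simp only; linarith⟩⟩
    have := congrArg Prod.fst (hCZ.2.1 (hmem _ hE.2.1) (hmem _ hE.2.2.1))
    norm_num at this
  rcases hCZ.1 with ⟨hx, hy, h⟩ | ⟨k, i, j, -, -, -, -, hx, hy, h⟩
  · apply hsmall
    rw [hx, hy, h]
    norm_num
  · have hs4 : 1 / 4 ≤ Q.s := by
      have hk : k < 3 := by
        by_contra! hk
        have : Q.s ≤ (2 : ℝ) ^ (-(3 : ℤ)) := by
          rw [h]
          exact zpow_le_zpow_right₀ (by norm_num) (by omega)
        norm_num only at this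
        linarith
      rw [h]
      calc (1 / 4 : ℝ) = (2 : ℝ) ^ (-(2 : ℤ)) := by norm_num
        _ ≤ _ := zpow_le_zpow_right₀ (by norm_num) (by omega)
    rw [← h] at hx hy
    simp only [hx] at hu₁ hu₂
    simp only [hy] at hv₁ hv₂
    obtain ⟨hi₁, hi₂⟩ := int_mem_of_dilate_near_zero hs4 hu₃ hu₄ hu₁ hu₂
    obtain ⟨hj₁, hj₂⟩ := int_mem_of_dilate_near_zero hs4 hv₃ hv₄ hv₁ hv₂
    apply hsmall
    rw [hx, hy]
    refine ⟨?_, ?_, ?_, ?_⟩ <;> nlinarith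

/-- The left end of `9I` is to the right of `-1` for every relevant shadow `I`. -/
theorem Relevant.neg_one_le {Ebar : Finset ℝ} (hE : EbarHyp Ebar) {Q : Sq}
    (hQ : Relevant Ebar Q) : -1 ≤ Q.x - 4 * Q.s := by
  have hs := hQ.side_le hE
  obtain ⟨-, z, ⟨⟨-, hz⟩, -⟩, ⟨⟨hz', -⟩, -⟩⟩ := hQ
  norm_num only at hz'
  linarith

/-- a shadow `I` of a CZ square belongs to `Gp(x*)` for at most one
`x* ∈ Ē⁺`; and if `K ≥ 41` and `I` is a hard relevant shadow, then `I ∈ Gp(x*)` for some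
`x* ∈ Ē⁺`. -/
theorem group_membership_dichotomy (K : ℝ) (hK : 0 < K)
    (Ebar : Finset ℝ) (hE : EbarHyp Ebar) (I : Iv) (hI : IsShadow Ebar I) :
    (∀ x₁ ∈ EbarPlus Ebar, ∀ x₂ ∈ EbarPlus Ebar,
      Gp Ebar x₁ I → Gp Ebar x₂ I → x₁ = x₂) ∧
    (41 ≤ K → ¬EasyShadow Ebar K I →
      (∃ Q : Sq, Relevant Ebar Q ∧ shadow Q = I) →
      ∃ xstar ∈ EbarPlus Ebar, Gp Ebar xstar I) := by
  constructor
  · obtain ⟨Q, hQ, rfl⟩ := hI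
    have hpos : 0 < (shadow Q).len := hQ.side_pos
    rintro x₁ hx₁ x₂ hx₂ ⟨-, ha₁, hb₁⟩ ⟨-, ha₂, hb₂⟩
    rcases lt_trichotomy x₁ x₂ with h | h | h
    · exact absurd ⟨h, by linarith⟩ (hb₁ x₂ hx₂)
    · exact h
    · exact absurd ⟨h, by linarith⟩ (hb₂ x₁ hx₁)
  · rintro hK41 hhard ⟨Q, hrel, rfl⟩
    have hpos := hrel.1.side_pos
    have hs := hrel.side_le hE
    obtain ⟨xstar, hx, hmax⟩ := ((EbarPlus Ebar).filter (· ≤ Q.x - 4 * Q.s)).exists_max_image id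
      ⟨-1, Finset.mem_filter.2 ⟨Finset.mem_insert_self _ _, hrel.neg_one_le hE⟩⟩
    obtain ⟨hxE, hxle⟩ := Finset.mem_filter.1 hx
    refine ⟨xstar, hxE, hI, ?_, fun x hxm ⟨hlt, hle⟩ =>
      (hmax x (Finset.mem_filter.2 ⟨hxm, hle⟩)).not_gt hlt⟩
    by_contra! hgt
    obtain ⟨v, hv, hv₁, hv₂⟩ := hrel.1.exists_mem_near (by linarith)
    have hKs : 41 * Q.s ≤ K * Q.s := by gcongr
    simp only [shadow] at hgt
    refine hhard ⟨v, Finset.mem_insert_of_mem hv, xstar, hxE, ?_, ?_, ?_⟩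
    · constructor <;> simp only [shadow] <;> linarith
    · constructor <;> simp only [shadow] <;> linarith
    · calc K⁻¹ * Q.s ≤ 1 * Q.s := by
            gcongr
            exact inv_le_one_of_one_le₀ (by linarith)
        _ ≤ v - xstar := by linarith
        _ ≤ |v - xstar| := le_abs_self _
end

section
/- Let x* ∈ Ē⁺ and let J, J' ∈ Gp(x*). Then 9J ∩ 9J' ≠ ∅. -/
namespace Sq

theorem IsDyadic.s_pos {Q : Sq} (hQ : Q.IsDyadic) : 0 < Q.s := by
  rcases hQ with ⟨-, -, hs⟩ | ⟨k, i, j, -, -, -, -, -, -, hs⟩ <;> rw [hs] <;> positivity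

/-- Every dyadic square other than `Q⁰` arises by bisecting a dyadic square. -/
theorem IsDyadic.exists_parent_s14 {Q : Sq} (hQ : Q.IsDyadic) :
    (Q.x = -1 ∧ Q.y = -1 ∧ Q.s = 2) ∨
      ∃ P : Sq, P.IsDyadic ∧ P.s = 2 * Q.s ∧ (P.x = Q.x ∨ P.x = Q.x - Q.s) ∧
        (P.y = Q.y ∨ P.y = Q.y - Q.s) := by
  rcases hQ with h | ⟨k, i, j, hi, hi', hj, hj', hx, hy, hs⟩
  · exact .inl h
  right
  cases k with
  | zero =>
    refine ⟨⟨-1, -1, 2⟩, .inl ⟨rfl, rfl, rfl⟩, by simp [hs], ?_, ?_⟩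
    · obtain rfl | rfl : i = -1 ∨ i = 0 := by simp at hi hi'; omega
      all_goals simp [hx, hs]
    · obtain rfl | rfl : j = -1 ∨ j = 0 := by simp at hj hj'; omega
      all_goals simp [hy, hs]
  | succ k =>
    have hpow : (2 : ℤ) ^ (k + 1) = 2 * 2 ^ k := pow_succ' 2 k
    have hscale : (2 : ℝ) ^ (-(k : ℤ)) = 2 * (2 : ℝ) ^ (-((k + 1 : ℕ) : ℤ)) := by
      rw [← zpow_one_add₀ two_ne_zero]
      congr 1
      push_cast
      ring
    have half (m : ℤ) (c : ℝ) : ((m / 2 : ℤ) : ℝ) * (2 * c) = m * c ∨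
        ((m / 2 : ℤ) : ℝ) * (2 * c) = m * c - c := by
      obtain h | h : m = 2 * (m / 2) ∨ m = 2 * (m / 2) + 1 := by omega
      · left
        have h' : (m : ℝ) = 2 * ((m / 2 : ℤ) : ℝ) := by exact_mod_cast h
        rw [h']
        ring
      · right
        have h' : (m : ℝ) = 2 * ((m / 2 : ℤ) : ℝ) + 1 := by exact_mod_cast h
        rw [h']
        ring
    refine ⟨⟨(i / 2 : ℤ) * (2 : ℝ) ^ (-(k : ℤ)), (j / 2 : ℤ) * (2 : ℝ) ^ (-(k : ℤ)),
      (2 : ℝ) ^ (-(k : ℤ))⟩, .inr ⟨k, i / 2, j / 2, by omega, by omega, by omega, by omega,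
      rfl, rfl, rfl⟩, ?_, ?_, ?_⟩
    · rw [hs, hscale]
    · rw [hx, hs, hscale]
      exact half i _
    · rw [hy, hs, hscale]
      exact half j _

end Sq

/-- Since the points `±2⁻¹¹` lie in `E ∩ 3Q⁰`, the square `Q⁰` is not a CZ square. -/
theorem CZ.ne_root {Ebar : Finset ℝ} (hE : EbarHyp Ebar) {Q : Sq} (hQ : CZ Ebar Q) :
    ¬(Q.x = -1 ∧ Q.y = -1 ∧ Q.s = 2) := by
  rintro ⟨hx, hy, hs⟩
  obtain ⟨-, hmax, hmin, -⟩ := hE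
  have h := @hQ.2.1 ((2 : ℝ) ^ (-(11 : ℤ)), 0) ⟨⟨hmax, rfl⟩, by
    simp only [Sq.dilate, hx, hy, hs, Set.mem_prod, Set.mem_Ioo]; norm_num⟩
    (-(2 : ℝ) ^ (-(11 : ℤ)), 0) ⟨⟨hmin, rfl⟩, by
    simp only [Sq.dilate, hx, hy, hs, Set.mem_prod, Set.mem_Ioo]; norm_num⟩
  have := congrArg Prod.fst h
  norm_num at this

/-- Every shadow `I` has positive length and satisfies `Ē ∩ 7I ≠ ∅`. -/
theorem IsShadow.len_pos_and_exists_mem {Ebar : Finset ℝ} (hE : EbarHyp Ebar) {I : Iv}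
    (hI : IsShadow Ebar I) :
    0 < I.len ∧ ∃ e ∈ Ebar, I.a - 3 * I.len < e ∧ e < I.a + 4 * I.len := by
  obtain ⟨Q, hQ, rfl⟩ := hI
  have hpos := hQ.1.s_pos
  refine ⟨hpos, ?_⟩
  obtain h | ⟨P, hP, hs, hx, hy⟩ := hQ.1.exists_parent_s14
  · exact absurd h (hQ.ne_root hE)
  have hsub : Q.set ⊆ P.set := by
    refine Set.prod_mono (Set.Icc_subset_Icc ?_ ?_) (Set.Icc_subset_Icc ?_ ?_)
    · rcases hx with hx | hx <;> linarith
    · rcases hx with hx | hx <;> linarith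
    · rcases hy with hy | hy <;> linarith
    · rcases hy with hy | hy <;> linarith
  have hne : Q.set ≠ P.set := by
    intro heq
    have hl : (P.x, P.y) ∈ Q.set := by
      rw [heq]
      simp only [Sq.set, Set.mem_prod, Set.mem_Icc]
      refine ⟨⟨?_, ?_⟩, ?_, ?_⟩ <;> linarith
    have hr : (P.x + P.s, P.y + P.s) ∈ Q.set := by
      rw [heq]
      simp only [Sq.set, Set.mem_prod, Set.mem_Icc]
      refine ⟨⟨?_, ?_⟩, ?_, ?_⟩ <;> linarith
    linarith [hl.1.1, hr.1.2]
  have hns : ¬(Eset Ebar ∩ P.dilate 3).Subsingleton := fun h => hne (hQ.2.2 P hP h hsub)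
  obtain ⟨z, hzE, hzP⟩ := (Set.not_subsingleton_iff.mp hns).nonempty
  refine ⟨z.1, hzE.1, ?_⟩
  obtain ⟨hz₁, hz₂⟩ := hzP.1
  simp only [shadow]
  rcases hx with hx | hx <;> constructor <;> linarith

theorem Gp.inf_lt_sup {Ebar : Finset ℝ} (hE : EbarHyp Ebar) {xstar : ℝ} {J J' : Iv}
    (hJ : Gp Ebar xstar J) (hJ' : Gp Ebar xstar J') :
    J'.a - 4 * J'.len < J.a + 5 * J.len := by
  obtain ⟨hpos, e, heE, he₁, he₂⟩ := hJ.1.len_pos_and_exists_mem hE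
  have hfar := hJ.2.1
  by_contra! hle
  exact hJ'.2.2 e (Finset.mem_insert_of_mem heE) ⟨by linarith, by linarith⟩

/-- if `J, J' ∈ Gp(x*)` for `x* ∈ Ē⁺`, then `9J ∩ 9J' ≠ ∅`. -/
theorem group_shadows_meet (Ebar : Finset ℝ) (hE : EbarHyp Ebar)
    (xstar : ℝ) (hx : xstar ∈ EbarPlus Ebar)
    (J J' : Iv) (hJ : Gp Ebar xstar J) (hJ' : Gp Ebar xstar J') :
    (J.dil 9 ∩ J'.dil 9).Nonempty := by
  have hpos := (hJ.1.len_pos_and_exists_mem hE).1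
  have hpos' := (hJ'.1.len_pos_and_exists_mem hE).1
  have h := hJ.inf_lt_sup hE hJ'
  have h' := hJ'.inf_lt_sup hE hJ
  rw [Iv.dil, Iv.dil, Set.Ioo_inter_Ioo, Set.nonempty_Ioo, max_lt_iff, lt_min_iff, lt_min_iff]
  refine ⟨⟨?_, ?_⟩, ?_, ?_⟩ <;> linarith
end
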